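/- Assume z≥1 satisfies P(Q(0)>0 and Q(z)>0)>0. Then for every sequence (kₙ) of positive integers such that kₙ≥z for all sufficiently large n and kₙ/n→0 as n→∞, one has lim_{n→∞}(1/n)·log P_z(1≤Zₙ≤kₙ) = lim_{n→∞}(1/n)·log P_z(Zₙ=z) (both limits exist and are finite). -/

import Mathlib

open MeasureTheory ProbabilityTheory Filter Topology

noncomputable section

/-- `q` is a probability mass function on `ℕ`. -/
def IsPMF (q : ℕ → ℝ) : Prop := (∀ k, 0 ≤ q k) ∧ (∑' k, q k) = 1

/-- Mean `m_q` of a mass function on `ℕ`. -/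
def pmfMean (q : ℕ → ℝ) : ℝ := ∑' k : ℕ, (k : ℝ) * q k

/-- `X = log m_Q`. -/
def envX (q : ℕ → ℝ) : ℝ := Real.log (pmfMean q)

/-- Probability generating function of `q`. -/
def pgf (q : ℕ → ℝ) (s : ℝ) : ℝ := ∑' k, q k * s ^ k

/-- Derivative `f'` of the probability generating function of `q`. -/
def dpgf (q : ℕ → ℝ) (s : ℝ) : ℝ := ∑' k : ℕ, (k : ℝ) * q k * s ^ (k - 1)

/-- Second factorial moment `f''(1)` of `q`. -/
def pgf2 (q : ℕ → ℝ) : ℝ := ∑' k : ℕ, (k : ℝ) * ((k : ℝ) - 1) * q k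

/-- Convolution of two mass functions on `ℕ`. -/
def conv (q r : ℕ → ℝ) (k : ℕ) : ℝ := ∑ j ∈ Finset.range (k + 1), q j * r (k - j)

/-- `z`-fold convolution power `q^{*z}`. -/
def convPow (q : ℕ → ℝ) : ℕ → ℕ → ℝ
  | 0 => fun k => if k = 0 then 1 else 0
  | z + 1 => conv q (convPow q z)

/-- Quenched `n`-step transition probabilities of the branching process in the (varying)
environment `e`, where `e i` is the offspring distribution of generation `i + 1`:
`qtrans e n k j = P(Z_n = j | Z_0 = k, environment e)`. -/
def qtrans (e : ℕ → ℕ → ℝ) : ℕ → ℕ → ℕ → ℝ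
  | 0, k, j => if j = k then 1 else 0
  | n + 1, k, j => ∑' i : ℕ, qtrans e n k i * convPow (e n) i j

/-- Composition `f_{i,n} = f_{i+1} ∘ ⋯ ∘ f_n` of generating functions, where `e m` is the
offspring distribution `Q_{m+1}`. -/
def Fcomp (e : ℕ → ℕ → ℝ) (i n : ℕ) (s : ℝ) : ℝ :=
  (List.range (n - i)).foldr (fun m t => pgf (e (i + m)) t) s

/-- Extension of a finite environment to an infinite one (by a trivial environment). -/
def extEnv (n : ℕ) (e : Fin n → ℕ → ℝ) : ℕ → ℕ → ℝ := fun i =>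
  if h : i < n then e ⟨i, h⟩ else fun k => if k = 1 then 1 else 0

/-- Law of the first `n` generations of an i.i.d. environment with marginal `ν`. -/
def envPi (ν : Measure (ℕ → ℝ)) [SigmaFinite ν] (n : ℕ) :
    Measure (Fin n → ℕ → ℝ) :=
  Measure.pi fun _ : Fin n => ν

/-- Annealed probability `P_k(Z_n = j)` of the BPRE whose environment is i.i.d. with
marginal law `ν`. -/
def aP (ν : Measure (ℕ → ℝ)) [SigmaFinite ν] (n k j : ℕ) : ℝ :=
  ∫ e, qtrans (extEnv n e) n k j ∂(envPi ν n)

/-- The set `𝓘 = {j ≥ 1 : P(Q(j) > 0, Q(0) > 0) > 0}`. -/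
def Iset (ν : Measure (ℕ → ℝ)) : Set ℕ :=
  {j | 1 ≤ j ∧ 0 < ν {q | 0 < q j ∧ 0 < q 0}}

/-- The set `Cl(𝓘)` of states reachable from `𝓘`. -/
def clI (ν : Measure (ℕ → ℝ)) [SigmaFinite ν] : Set ℕ :=
  {k | 1 ≤ k ∧ ∃ n, ∃ j ∈ Iset ν, 0 < aP ν n j k}

/-- The set `Cl({z})` of states reachable from `z`. -/
def clz (ν : Measure (ℕ → ℝ)) [SigmaFinite ν] (z : ℕ) : Set ℕ :=
  {k | 1 ≤ k ∧ ∃ n, 0 < aP ν n z k}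

/-- The spine (Geiger) expectation
`E[Q_n(z₀) f_{0,n}(0)^{z₀-1} ∏_{i=1}^{n-1} f_i'(f_{i,n}(0))]`. -/
def geigerExp (ν : Measure (ℕ → ℝ)) [SigmaFinite ν] (z₀ n : ℕ) : ℝ :=
  ∫ e, (extEnv n e (n - 1)) z₀ * (Fcomp (extEnv n e) 0 n 0) ^ (z₀ - 1) *
      ∏ i ∈ Finset.Icc 1 (n - 1), dpgf (extEnv n e (i - 1)) (Fcomp (extEnv n e) i n 0)
    ∂(envPi ν n)

/-- `Λ(0) = - log inf_{λ ≥ 0} E[e^{-λ X}]`, the rate function of `S` at `0`. -/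
def Lam0 (ν : Measure (ℕ → ℝ)) : ℝ :=
  - Real.log (sInf ((fun l : ℝ => ∫ q, Real.exp (-(l * envX q)) ∂ν) '' {l : ℝ | 0 ≤ l}))

/-- Truncated standardized second moment `ξ_q(a)`. -/
def xi (q : ℕ → ℝ) (a : ℕ) : ℝ :=
  (∑' y : ℕ, if a ≤ y then (y : ℝ) ^ 2 * q y else 0) / (pmfMean q) ^ 2

/-- Assumption A2 : the random walk is non-lattice and a truncated moment condition holds. -/
def AssumptionA2 (ν : Measure (ℕ → ℝ)) : Prop :=
  (∀ r : ℝ, 0 < r → ν {q | ∃ m : ℤ, envX q = r * m} < 1) ∧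
  ∃ ε : ℝ, 0 < ε ∧ ∃ a : ℕ, ∀ x : ℝ, 0 < x →
    IntegrableOn (fun q => Real.log (max (xi q a) 1) ^ ((2 : ℝ) + ε))
      {q | -x < envX q} ν

/-- `q` has a linear fractional generating function with mean `m = pmfMean q` and
second derivative `b` at `1`. -/
def IsLF (q : ℕ → ℝ) : Prop :=
  0 < pmfMean q ∧ ∃ b : ℝ, 0 ≤ b ∧ ∀ s ∈ Set.Icc (0 : ℝ) 1,
    pgf q s = 1 - (1 - s) / ((pmfMean q)⁻¹ + b * ((pmfMean q) ^ 2)⁻¹ * (1 - s) / 2)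

lemma IsPMF.summ {q : ℕ → ℝ} (h : IsPMF q) : Summable q := by
  by_contra hc
  have := h.2
  rw [tsum_eq_zero_of_not_summable hc] at this
  norm_num at this

lemma convPow_isPMF {q : ℕ → ℝ} (h : IsPMF q) (i : ℕ) : IsPMF (convPow q i) := by
  induction i with
  | zero =>
    refine ⟨fun k => ?_, ?_⟩
    · simp only [convPow]; split_ifs <;> norm_num
    · simp only [convPow]; exact tsum_ite_eq 0 (fun _ => (1 : ℝ))
  | succ i ih =>
    refine ⟨fun k => ?_, ?_⟩
    · simp only [convPow, conv]
      exact Finset.sum_nonneg fun j _ => mul_nonneg (h.1 _) (ih.1 _)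
    · have := tsum_mul_tsum_eq_tsum_sum_range_of_summable_norm h.summ.norm ih.summ.norm
      rw [h.2, ih.2, one_mul] at this
      exact this.symm

lemma IsPMF.le_one {q : ℕ → ℝ} (h : IsPMF q) (k : ℕ) : q k ≤ 1 := by
  rw [← h.2]
  exact h.summ.le_tsum k (fun j _ => h.1 j)

lemma summ_step {r : ℕ → ℝ} {q : ℕ → ℝ} (hr : IsPMF r) (hq : IsPMF q) (j : ℕ) :
    Summable fun i => r i * convPow q i j :=
  Summable.of_nonneg_of_le (fun i => mul_nonneg (hr.1 i) ((convPow_isPMF hq i).1 j))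
    (fun i => mul_le_of_le_one_right (hr.1 i) ((convPow_isPMF hq i).le_one j)) hr.summ

lemma isPMF_step {r : ℕ → ℝ} {q : ℕ → ℝ} (hr : IsPMF r) (hq : IsPMF q) :
    IsPMF fun j => ∑' i, r i * convPow q i j := by
  have hc := convPow_isPMF hq
  generalize convPow q = c at hc
  refine ⟨fun j => tsum_nonneg fun i => mul_nonneg (hr.1 i) ((hc i).1 j), ?_⟩
  have hin : ∀ i, ∑' j, r i * c i j = r i := fun i => by
    rw [tsum_mul_left, (hc i).2, mul_one]
  have hs : Summable (Function.uncurry fun i j => r i * c i j) := by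
    rw [summable_prod_of_nonneg]
    · refine ⟨fun i => ?_, ?_⟩
      · simp only [Function.uncurry]
        exact (hc i).summ.mul_left _
      · simpa [Function.uncurry, hin] using hr.summ
    · rintro ⟨i, j⟩
      exact mul_nonneg (hr.1 i) ((hc i).1 j)
  have h2 : ∑' j, ∑' i, r i * c i j = ∑' i, ∑' j, r i * c i j := hs.tsum_comm
  rw [h2]
  simp_rw [hin]
  exact hr.2

lemma qtrans_isPMF {e : ℕ → ℕ → ℝ} (he : ∀ i, IsPMF (e i)) (n k : ℕ) :
    IsPMF (qtrans e n k) := by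
  induction n with
  | zero =>
    refine ⟨fun j => ?_, ?_⟩
    · simp only [qtrans]; split_ifs <;> norm_num
    · simp only [qtrans]; exact tsum_ite_eq k (fun _ => (1 : ℝ))
  | succ n ih => exact isPMF_step ih (he n)

lemma qtrans_congr {e e' : ℕ → ℕ → ℝ} (n k : ℕ) (h : ∀ i < n, e i = e' i) (j : ℕ) :
    qtrans e n k j = qtrans e' n k j := by
  induction n generalizing j with
  | zero => rfl
  | succ n ih =>
    simp only [qtrans]
    rw [h n (Nat.lt_succ_self n)]
    congr 1; funext i
    rw [ih (fun i hi => h i (by omega))]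

lemma qtrans_ck {e : ℕ → ℕ → ℝ} (he : ∀ i, IsPMF (e i)) (m n k : ℕ) (S : Finset ℕ) (j : ℕ) :
    ∑ i ∈ S, qtrans e m k i * qtrans (fun l => e (m + l)) n i j ≤ qtrans e (m + n) k j := by
  induction n generalizing j with
  | zero =>
    simp only [qtrans, add_zero, mul_ite, mul_one, mul_zero]
    rw [Finset.sum_ite_eq]
    split_ifs
    · exact le_rfl
    · exact (qtrans_isPMF he m k).1 j
  | succ n ih =>
    have he' : ∀ i, IsPMF ((fun l => e (m + l)) i) := fun i => he _
    have hs : ∀ i ∈ S, Summable fun l => qtrans e m k i *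
        (qtrans (fun l => e (m + l)) n i l * convPow (e (m + n)) l j) := fun i _ =>
      (summ_step (qtrans_isPMF he' n i) (he (m + n)) j).mul_left _
    calc ∑ i ∈ S, qtrans e m k i * qtrans (fun l => e (m + l)) (n + 1) i j
        = ∑ i ∈ S, ∑' l, qtrans e m k i *
          (qtrans (fun l => e (m + l)) n i l * convPow (e (m + n)) l j) := by
          refine Finset.sum_congr rfl fun i _ => ?_
          rw [tsum_mul_left]; rfl
      _ = ∑' l, ∑ i ∈ S, qtrans e m k i *
          (qtrans (fun l => e (m + l)) n i l * convPow (e (m + n)) l j) :=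
          (Summable.tsum_finsetSum hs).symm
      _ ≤ ∑' l, qtrans e (m + n) k l * convPow (e (m + n)) l j := by
          refine Summable.tsum_le_tsum (fun l => ?_) (summable_sum hs)
            (summ_step (qtrans_isPMF he (m + n) k) (he (m + n)) j)
          simp_rw [← mul_assoc]
          rw [← Finset.sum_mul]
          exact mul_le_mul_of_nonneg_right (ih l) ((convPow_isPMF (he _) l).1 j)
      _ = qtrans e (m + (n + 1)) k j := rfl

lemma measurable_convPow (i j : ℕ) : Measurable fun q : ℕ → ℝ => convPow q i j := by
  induction i generalizing j with
  | zero => exact measurable_const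
  | succ i ih =>
    simp only [convPow, conv]
    exact Finset.measurable_sum _ fun l _ => (measurable_pi_apply l).mul (ih _)

lemma measurable_qtrans (n k j : ℕ) : Measurable fun e : ℕ → ℕ → ℝ => qtrans e n k j := by
  induction n generalizing j with
  | zero => exact measurable_const
  | succ n ih =>
    simp only [qtrans]
    exact Measurable.tsum fun i =>
      (ih i).mul ((measurable_convPow i j).comp (measurable_pi_apply n))

lemma measurable_extEnv (n : ℕ) : Measurable (extEnv n) := by
  refine measurable_pi_iff.2 fun i => ?_
  unfold extEnv
  by_cases h : i < n
  · simp only [h, dite_true]; exact measurable_pi_apply _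
  · simp only [h, dite_false]; exact measurable_const

lemma isPMF_triv : IsPMF fun k => if k = 1 then 1 else 0 := by
  refine ⟨fun j => ?_, ?_⟩
  · dsimp only; split_ifs <;> norm_num
  · exact tsum_ite_eq 1 (fun _ => (1 : ℝ))

lemma extEnv_isPMF {n : ℕ} {e : Fin n → ℕ → ℝ} (he : ∀ i, IsPMF (e i)) (i : ℕ) :
    IsPMF (extEnv n e i) := by
  unfold extEnv
  split_ifs with h
  · exact he _
  · exact isPMF_triv

section
variable (ν : Measure (ℕ → ℝ)) [IsProbabilityMeasure ν]

instance (n : ℕ) : IsProbabilityMeasure (envPi ν n) := by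
  unfold envPi; infer_instance

lemma ae_env (hpmf : ∀ᵐ q ∂ν, IsPMF q) (n : ℕ) : ∀ᵐ e ∂(envPi ν n), ∀ i, IsPMF (e i) := by
  rw [ae_all_iff]
  intro i
  exact (measurePreserving_eval (fun _ : Fin n => ν) i).quasiMeasurePreserving.ae hpmf

lemma envPi_add (m n : ℕ) : envPi ν (m + n) =
    ((envPi ν m).prod (envPi ν n)).map (fun p => Fin.append p.1 p.2) := by
  have hm : Measurable fun p : (Fin m → ℕ → ℝ) × (Fin n → ℕ → ℝ) => Fin.append p.1 p.2 := by
    refine measurable_pi_iff.2 fun i => ?_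
    refine Fin.addCases (fun i => ?_) (fun i => ?_) i
    · simp only [Fin.append_left]; exact (measurable_pi_apply i).comp measurable_fst
    · simp only [Fin.append_right]; exact (measurable_pi_apply i).comp measurable_snd
  refine Measure.pi_eq fun s hs => ?_
  rw [Measure.map_apply hm (MeasurableSet.univ_pi hs)]
  have : (fun p : (Fin m → ℕ → ℝ) × (Fin n → ℕ → ℝ) => Fin.append p.1 p.2) ⁻¹' (Set.univ.pi s)
      = (Set.univ.pi fun i => s (Fin.castAdd n i)) ×ˢ (Set.univ.pi fun i => s (Fin.natAdd m i)) := by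
    ext p
    simp only [Set.mem_preimage, Set.mem_pi, Set.mem_univ, true_imp_iff, Set.mem_prod,
      Fin.forall_fin_add, Fin.append_left, Fin.append_right]
  rw [this, Measure.prod_prod, envPi, envPi, Measure.pi_pi, Measure.pi_pi, Fin.prod_univ_add]

lemma meas_append (m n : ℕ) : Measurable
    fun p : (Fin m → ℕ → ℝ) × (Fin n → ℕ → ℝ) => Fin.append p.1 p.2 := by
  refine measurable_pi_iff.2 fun i => ?_
  refine Fin.addCases (fun i => ?_) (fun i => ?_) i
  · simp only [Fin.append_left]; exact (measurable_pi_apply i).comp measurable_fst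
  · simp only [Fin.append_right]; exact (measurable_pi_apply i).comp measurable_snd

lemma meas_q (n k j : ℕ) : Measurable fun e : Fin n → ℕ → ℝ => qtrans (extEnv n e) n k j :=
  (measurable_qtrans n k j).comp (measurable_extEnv n)

lemma integrable_q (hpmf : ∀ᵐ q ∂ν, IsPMF q) (n k j : ℕ) :
    Integrable (fun e : Fin n → ℕ → ℝ => qtrans (extEnv n e) n k j) (envPi ν n) := by
  refine Integrable.of_bound (meas_q n k j).aestronglyMeasurable 1 ?_
  filter_upwards [ae_env ν hpmf n] with e he
  have := qtrans_isPMF (extEnv_isPMF he) n k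
  rw [Real.norm_of_nonneg (this.1 j)]
  exact this.le_one j

lemma aP_nonneg (hpmf : ∀ᵐ q ∂ν, IsPMF q) (n k j : ℕ) : 0 ≤ aP ν n k j := by
  refine integral_nonneg_of_ae ?_
  filter_upwards [ae_env ν hpmf n] with e he
  exact (qtrans_isPMF (extEnv_isPMF he) n k).1 j

lemma aP_le_one (hpmf : ∀ᵐ q ∂ν, IsPMF q) (n k j : ℕ) : aP ν n k j ≤ 1 := by
  have : aP ν n k j ≤ ∫ _, (1 : ℝ) ∂(envPi ν n) := by
    refine integral_mono_ae (integrable_q ν hpmf n k j) (integrable_const _) ?_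
    filter_upwards [ae_env ν hpmf n] with e he
    exact (qtrans_isPMF (extEnv_isPMF he) n k).le_one j
  simpa using this

lemma aP_ck (hpmf : ∀ᵐ q ∂ν, IsPMF q) (m n k : ℕ) (S : Finset ℕ) (j : ℕ) :
    ∑ i ∈ S, aP ν m k i * aP ν n i j ≤ aP ν (m + n) k j := by
  have h1 : aP ν (m + n) k j = ∫ p, qtrans (extEnv (m + n) (Fin.append p.1 p.2)) (m + n) k j
      ∂((envPi ν m).prod (envPi ν n)) := by
    unfold aP
    rw [envPi_add, integral_map (meas_append m n).aemeasurable
      (meas_q (m + n) k j).aestronglyMeasurable]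
  have hi : ∀ i ∈ S, Integrable (fun p : (Fin m → ℕ → ℝ) × (Fin n → ℕ → ℝ) =>
      qtrans (extEnv m p.1) m k i * qtrans (extEnv n p.2) n i j)
      ((envPi ν m).prod (envPi ν n)) := fun i _ =>
    (integrable_q ν hpmf m k i).mul_prod (integrable_q ν hpmf n i j)
  have h2 : ∑ i ∈ S, aP ν m k i * aP ν n i j = ∫ p, ∑ i ∈ S,
      qtrans (extEnv m p.1) m k i * qtrans (extEnv n p.2) n i j
      ∂((envPi ν m).prod (envPi ν n)) := by
    rw [integral_finsetSum _ hi]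
    refine Finset.sum_congr rfl fun i _ => ?_
    exact (integral_prod_mul (fun e => qtrans (extEnv m e) m k i)
      (fun e => qtrans (extEnv n e) n i j)).symm
  rw [h1, h2]
  refine integral_mono_ae (integrable_finsetSum _ hi) ?_ ?_
  · have := integrable_q ν hpmf (m + n) k j
    rw [envPi_add] at this
    exact this.comp_measurable (meas_append m n)
  · have ha := (Measure.quasiMeasurePreserving_fst (μ := envPi ν m) (ν := envPi ν n)).ae
      (ae_env ν hpmf m)
    have hb := (Measure.quasiMeasurePreserving_snd (μ := envPi ν m) (ν := envPi ν n)).ae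
      (ae_env ν hpmf n)
    filter_upwards [ha, hb] with p hp1 hp2
    have hp : ∀ i, IsPMF (Fin.append p.1 p.2 i) := by
      intro i
      refine Fin.addCases (fun i => ?_) (fun i => ?_) i
      · simpa only [Fin.append_left] using hp1 i
      · simpa only [Fin.append_right] using hp2 i
    refine le_trans (le_of_eq ?_) (qtrans_ck (extEnv_isPMF hp) m n k S j)
    refine Finset.sum_congr rfl fun i _ => ?_
    congr 1
    · refine qtrans_congr m k (fun l hl => ?_) i
      unfold extEnv
      rw [dif_pos hl, dif_pos (by omega)]
      exact (Fin.append_left p.1 p.2 ⟨l, hl⟩).symm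
    · refine qtrans_congr n i (fun l hl => ?_) j
      simp only [extEnv]
      rw [dif_pos hl, dif_pos (by omega)]
      exact (Fin.append_right p.1 p.2 ⟨l, hl⟩).symm

lemma convPow_lower {q : ℕ → ℝ} (hq : IsPMF q) (z i : ℕ) :
    q 0 ^ i * q z ≤ convPow q (i + 1) z := by
  induction i with
  | zero =>
    have : convPow q 1 z = ∑ j ∈ Finset.range (z + 1), q j * convPow q 0 (z - j) := rfl
    rw [zero_add, this]
    refine le_trans (le_of_eq ?_) (Finset.single_le_sum
      (f := fun j => q j * convPow q 0 (z - j))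
      (fun j _ => mul_nonneg (hq.1 j) ((convPow_isPMF hq 0).1 _))
      (Finset.mem_range.2 (Nat.lt_succ_self z)))
    simp [convPow]
  | succ i ih =>
    have : convPow q (i + 1 + 1) z =
      ∑ j ∈ Finset.range (z + 1), q j * convPow q (i + 1) (z - j) := rfl
    rw [this]
    refine le_trans ?_ (Finset.single_le_sum
      (f := fun j => q j * convPow q (i + 1) (z - j))
      (fun j _ => mul_nonneg (hq.1 j) ((convPow_isPMF hq (i + 1)).1 _))
      (Finset.mem_range.2 (Nat.succ_pos z)))
    rw [pow_succ', mul_assoc]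
    exact mul_le_mul_of_nonneg_left ih (hq.1 0)

lemma aP_one (k j : ℕ) : aP ν 1 k j = ∫ q, convPow q k j ∂ν := by
  have : ∀ e : Fin 1 → ℕ → ℝ, qtrans (extEnv 1 e) 1 k j = convPow (e 0) k j := by
    intro e
    simp only [qtrans, extEnv, ite_mul, one_mul, zero_mul, tsum_ite_eq]
    rfl
  unfold aP
  simp_rw [this]
  have h := measurePreserving_eval (fun _ : Fin 1 => ν) 0
  have h3 := integral_map (μ := envPi ν 1) (φ := Function.eval (0 : Fin 1))
    (f := fun q : ℕ → ℝ => convPow q k j)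
    h.measurable.aemeasurable (measurable_convPow k j).aestronglyMeasurable
  rw [show (envPi ν 1).map (Function.eval (0 : Fin 1)) = ν from h.map_eq] at h3
  exact h3.symm

lemma aP_one_lower (hpmf : ∀ᵐ q ∂ν, IsPMF q) (z : ℕ) (hQ : 0 < ν {q | 0 < q 0 ∧ 0 < q z}) :
    ∃ ε δ : ℝ, 0 < ε ∧ ε ≤ 1 ∧ 0 < δ ∧ ∀ i, 1 ≤ i → ε ^ i * δ ≤ aP ν 1 i z := by
  have hsub : {q : ℕ → ℝ | 0 < q 0 ∧ 0 < q z} ⊆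
      ⋃ N : ℕ, {q : ℕ → ℝ | 1 / ((N : ℝ) + 1) < q 0 ∧ 1 / ((N : ℝ) + 1) < q z} := by
    rintro q ⟨h0, h1⟩
    obtain ⟨N, hN⟩ := exists_nat_one_div_lt (lt_min h0 h1)
    exact Set.mem_iUnion.2 ⟨N, hN.trans_le (min_le_left _ _), hN.trans_le (min_le_right _ _)⟩
  obtain ⟨N, hN⟩ : ∃ N : ℕ,
      0 < ν {q : ℕ → ℝ | 1 / ((N : ℝ) + 1) < q 0 ∧ 1 / ((N : ℝ) + 1) < q z} := by
    by_contra! hc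
    have := measure_mono_null hsub (measure_iUnion_null fun N => le_antisymm (hc N) zero_le)
    exact hQ.ne' this
  set ε : ℝ := 1 / ((N : ℝ) + 1) with hε
  have hε0 : 0 < ε := by positivity
  refine ⟨ε, ν.real {q : ℕ → ℝ | ε < q 0 ∧ ε < q z}, hε0, ?_, ?_, ?_⟩
  · rw [hε, div_le_one (by positivity)]; linarith [Nat.cast_nonneg (α := ℝ) N]
  · exact ENNReal.toReal_pos hN.ne' (measure_ne_top _ _)
  · intro i hi
    obtain ⟨i, rfl⟩ : ∃ l, i = l + 1 := ⟨i - 1, by omega⟩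
    rw [aP_one]
    have hint : Integrable (fun q : ℕ → ℝ => convPow q (i + 1) z) ν := by
      refine Integrable.of_bound (measurable_convPow _ _).aestronglyMeasurable 1 ?_
      filter_upwards [hpmf] with q hq
      have := convPow_isPMF hq (i + 1)
      rw [Real.norm_of_nonneg (this.1 z)]
      exact this.le_one z
    refine le_trans ?_ (mul_meas_ge_le_integral_of_nonneg
      (hpmf.mono fun q hq => (convPow_isPMF hq (i + 1)).1 z) hint (ε ^ (i + 1)))
    refine mul_le_mul_of_nonneg_left ?_ (by positivity)
    refine ENNReal.toReal_mono (measure_ne_top _ _) (measure_mono_ae ?_)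
    filter_upwards [hpmf] with q hq hA
    refine le_trans ?_ (convPow_lower hq z i)
    rw [pow_succ]
    exact mul_le_mul (pow_le_pow_left₀ hε0.le hA.1.le i) hA.2.le hε0.le
      (pow_nonneg (hq.1 0) i)

end

/-- Lemma 5.1, second part. If `z ≥ 1` satisfies
`P(Q(0) > 0, Q(z) > 0) > 0` and `(kₙ)` is a sequence of positive integers with `kₙ ≥ z`
eventually and `kₙ / n → 0`, then `(1/n) log P_z(1 ≤ Z_n ≤ kₙ)` and
`(1/n) log P_z(Z_n = z)` converge to the same finite limit. -/
theorem stmt2 (ν : Measure (ℕ → ℝ)) [IsProbabilityMeasure ν]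
    (hpmf : ∀ᵐ q ∂ν, IsPMF q)
    (z : ℕ) (hz : 1 ≤ z)
    (hQ : 0 < ν {q | 0 < q 0 ∧ 0 < q z})
    (k : ℕ → ℕ) (hkpos : ∀ n, 1 ≤ k n)
    (hkz : ∀ᶠ n in atTop, z ≤ k n)
    (hko : Tendsto (fun n : ℕ => (k n : ℝ) / (n : ℝ)) atTop (𝓝 0)) :
    ∃ L : ℝ,
      Tendsto (fun n : ℕ =>
          (1 / (n : ℝ)) * Real.log (∑ j ∈ Finset.Icc 1 (k n), aP ν n z j)) atTop (𝓝 L) ∧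
      Tendsto (fun n : ℕ => (1 / (n : ℝ)) * Real.log (aP ν n z z)) atTop (𝓝 L) := by
  obtain ⟨ε, δ, hε, hε1, hδ, hlow⟩ := aP_one_lower ν hpmf z hQ
  set a : ℕ → ℝ := fun n => aP ν n z z with ha
  have hsup : ∀ m n, a m * a n ≤ a (m + n) := fun m n => by
    simpa using aP_ck ν hpmf m n z {z} z
  have ha1 : 0 < a 1 := lt_of_lt_of_le (by positivity) (hlow z hz)
  have ha0 : 0 < a 0 := by
    simp [ha, aP, qtrans]
  have hpos : ∀ n, 0 < a n := by
    intro n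
    induction n with
    | zero => exact ha0
    | succ n ih => exact lt_of_lt_of_le (mul_pos ih ha1) (hsup n 1)
  have hle : ∀ n, a n ≤ 1 := fun n => aP_le_one ν hpmf n z z
  have hsub : Subadditive fun n => - Real.log (a n) := by
    intro m n
    have := Real.log_le_log (mul_pos (hpos m) (hpos n)) (hsup m n)
    rw [Real.log_mul (hpos m).ne' (hpos n).ne'] at this
    linarith
  have hbdd : BddBelow (Set.range fun n : ℕ => - Real.log (a n) / n) := by
    refine ⟨0, ?_⟩
    rintro _ ⟨n, rfl⟩
    have := Real.log_nonpos (hpos n).le (hle n)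
    exact div_nonneg (by linarith) (Nat.cast_nonneg n)
  have hlim := (hsub.tendsto_lim hbdd).neg
  set L : ℝ := - hsub.lim with hL
  have hA : Tendsto (fun n : ℕ => (1 / (n : ℝ)) * Real.log (a n)) atTop (𝓝 L) := by
    refine hlim.congr fun n => ?_
    ring
  refine ⟨L, ?_, hA⟩
  have hone : Tendsto (fun n : ℕ => 1 / (n : ℝ)) atTop (𝓝 0) :=
    tendsto_one_div_atTop_nhds_zero_nat
  have hup : Tendsto (fun n : ℕ => (1 + 1 / (n : ℝ)) *
      ((1 / ((n + 1 : ℕ) : ℝ)) * Real.log (a (n + 1)))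
      - (1 / (n : ℝ)) * Real.log δ - (k n : ℝ) / n * Real.log ε) atTop (𝓝 L) := by
    have h1 := (((hone.const_add 1).mul ((tendsto_add_atTop_iff_nat 1).2 hA)).sub
      (hone.mul_const (Real.log δ))).sub (hko.mul_const (Real.log ε))
    simpa using h1
  have hS : ∀ᶠ n in atTop, a n ≤ ∑ j ∈ Finset.Icc 1 (k n), aP ν n z j := by
    filter_upwards [hkz] with n hn
    exact Finset.single_le_sum (f := fun j => aP ν n z j)
      (fun j _ => aP_nonneg ν hpmf n z j) (Finset.mem_Icc.2 ⟨hz, hn⟩)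
  refine tendsto_of_tendsto_of_tendsto_of_le_of_le' hA hup ?_ ?_
  · filter_upwards [hS] with n hn
    exact mul_le_mul_of_nonneg_left (Real.log_le_log (hpos n) hn) (by positivity)
  · filter_upwards [hS, eventually_ge_atTop 1] with n hn hn1
    have hSpos := lt_of_lt_of_le (hpos n) hn
    have hn0 : (0 : ℝ) < n := by exact_mod_cast hn1
    have hkey : (∑ j ∈ Finset.Icc 1 (k n), aP ν n z j) * (ε ^ (k n) * δ) ≤ a (n + 1) := by
      refine le_trans ?_ (aP_ck ν hpmf n 1 z (Finset.Icc 1 (k n)) z)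
      rw [Finset.sum_mul]
      refine Finset.sum_le_sum fun j hj => ?_
      rw [Finset.mem_Icc] at hj
      refine mul_le_mul_of_nonneg_left (le_trans ?_ (hlow j hj.1)) (aP_nonneg ν hpmf n z j)
      exact mul_le_mul_of_nonneg_right (pow_le_pow_of_le_one hε.le hε1 hj.2) hδ.le
    have hlog := Real.log_le_log (by positivity) hkey
    rw [Real.log_mul hSpos.ne' (by positivity), Real.log_mul (by positivity) hδ.ne',
      Real.log_pow] at hlog
    have : (1 + 1 / (n : ℝ)) * ((1 / ((n + 1 : ℕ) : ℝ)) * Real.log (a (n + 1)))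
      - (1 / (n : ℝ)) * Real.log δ - (k n : ℝ) / n * Real.log ε =
      (1 / (n : ℝ)) * (Real.log (a (n + 1)) - Real.log δ - k n * Real.log ε) := by
      push_cast
      field_simp
    rw [this]
    exact mul_le_mul_of_nonneg_left (by linarith) (by positivity)

end
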